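/- For every continuously differentiable function f : Ω → ℝ with f ∈ L¹(Ω) ∩ L²(Ω) and ∇f ∈ L²(Ω), and for every R > 0, one has ‖f‖²_{L²(Ω)} ≤ ‖f‖²_{L¹(Ω)} · max(R, R²) + R^{−2} ‖∇f‖²_{L²(Ω)}. -/

import Mathlib

noncomputable section

open MeasureTheory Real

namespace NS

/-- The measure on the cylinder `Ω = ℝ × 𝕋`, identified with `ℝ × [0,1)`. -/
def μΩ : Measure (ℝ × ℝ) := volume.restrict (Set.univ ×ˢ Set.Ico (0:ℝ) 1)

/-- First partial derivative of a function on `ℝ²`. -/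
def pd1 (g : ℝ × ℝ → ℝ) (x : ℝ × ℝ) : ℝ := deriv (fun y => g (y, x.2)) x.1

/-- Second partial derivative of a function on `ℝ²`. -/
def pd2 (g : ℝ × ℝ → ℝ) (x : ℝ × ℝ) : ℝ := deriv (fun y => g (x.1, y)) x.2

/-- A function on the cylinder: `1`-periodic in the second variable. -/
def Periodic2 (g : ℝ × ℝ → ℝ) : Prop := ∀ x : ℝ × ℝ, g (x.1, x.2 + 1) = g x

/-- Second moment of a continuous function about a constant. -/
lemma integral_sub_const_sq {h : ℝ → ℝ} (hh : Continuous h) (a b c : ℝ) :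
    ∫ x in a..b, (h x - c) ^ 2 =
      (∫ x in a..b, h x ^ 2) - 2 * c * (∫ x in a..b, h x) + (b - a) * c ^ 2 := by
  have e : ∀ x, (h x - c) ^ 2 = h x ^ 2 - 2 * c * h x + c ^ 2 := fun x => by ring
  simp only [e]
  rw [intervalIntegral.integral_add, intervalIntegral.integral_sub,
    intervalIntegral.integral_const_mul, intervalIntegral.integral_const, smul_eq_mul]
  all_goals exact Continuous.intervalIntegrable (by fun_prop) _ _

/-- The Cauchy–Schwarz inequality against the constant function on an interval. -/
lemma sq_integral_le {h : ℝ → ℝ} (hh : Continuous h) {a b : ℝ} (hab : a ≤ b) :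
    (∫ x in a..b, h x) ^ 2 ≤ (b - a) * ∫ x in a..b, h x ^ 2 := by
  rcases hab.eq_or_lt with rfl | hlt
  · simp
  have hL : 0 < b - a := sub_pos.2 hlt
  have h0 : 0 ≤ ∫ x in a..b, (h x - (∫ x in a..b, h x) / (b - a)) ^ 2 :=
    intervalIntegral.integral_nonneg hab fun _ _ => sq_nonneg _
  rw [integral_sub_const_sq hh] at h0
  set I := ∫ x in a..b, h x
  set J := ∫ x in a..b, h x ^ 2
  have e : J - 2 * (I / (b - a)) * I + (b - a) * (I / (b - a)) ^ 2
      = ((b - a) * J - I ^ 2) / (b - a) := by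
    field_simp
    ring
  rw [e] at h0
  exact sub_nonneg.1 (by simpa only [div_mul_cancel₀ _ hL.ne', zero_mul] using
    mul_le_mul_of_nonneg_right h0 hL.le)

/-- The increment of a `C¹` function is controlled by the `L²` norm of its derivative. -/
lemma sq_sub_le_of_hasDerivAt {g g' : ℝ → ℝ} (hg : ∀ x, HasDerivAt g (g' x) x)
    (hg' : Continuous g') {a b : ℝ} (hab : a ≤ b) :
    (g b - g a) ^ 2 ≤ (b - a) * ∫ x in a..b, g' x ^ 2 := by
  rw [← intervalIntegral.integral_eq_sub_of_hasDerivAt (fun x _ => hg x)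
    (hg'.intervalIntegrable _ _)]
  exact sq_integral_le hg' hab

/-- A Poincaré inequality on an interval. -/
lemma integral_sq_le_of_hasDerivAt {g g' : ℝ → ℝ} (hg : ∀ x, HasDerivAt g (g' x) x)
    (hg' : Continuous g') {p q : ℝ} (hpq : p < q) :
    ∫ x in p..q, g x ^ 2 ≤
      (q - p)⁻¹ * (∫ x in p..q, g x) ^ 2 + (q - p) ^ 2 / 4 * ∫ x in p..q, g' x ^ 2 := by
  have hgc : Continuous g := continuous_iff_continuousAt.2 fun x => (hg x).continuousAt
  have hL : 0 < q - p := sub_pos.2 hpq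
  set m := (p + q) / 2 with hm
  have hpm : p ≤ m := by linarith
  have hmq : m ≤ q := by linarith
  have hnn : ∀ u v, u ≤ v → 0 ≤ ∫ x in u..v, g' x ^ 2 := fun u v huv =>
    intervalIntegral.integral_nonneg huv fun _ _ => sq_nonneg _
  have hint : ∀ u v, IntervalIntegrable (fun x => g' x ^ 2) volume u v := fun u v =>
    (hg'.pow 2).intervalIntegrable _ _
  have hadd : ∀ u v w, (∫ x in u..v, g' x ^ 2) + (∫ x in v..w, g' x ^ 2)
      = ∫ x in u..w, g' x ^ 2 := fun u v w =>
    intervalIntegral.integral_add_adjacent_intervals (hint _ _) (hint _ _)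
  have hci : ∀ u v, IntervalIntegrable (fun x => (g x - g m) ^ 2) volume u v := fun u v =>
    Continuous.intervalIntegrable (by fun_prop) _ _
  have left : ∫ x in p..m, (g x - g m) ^ 2 ≤
      (q - p) ^ 2 / 4 * ∫ x in p..m, g' x ^ 2 := by
    calc ∫ x in p..m, (g x - g m) ^ 2
        ≤ ∫ _ in p..m, (q - p) / 2 * ∫ x in p..m, g' x ^ 2 := by
          refine intervalIntegral.integral_mono_on hpm (hci _ _) (by simp) fun x hx => ?_
          have h1 := sq_sub_le_of_hasDerivAt hg hg' hx.2
          have h2 := hadd p x m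
          have h3 := hnn p x hx.1
          have h4 := hnn x m hx.2
          have h5 : m - x ≤ (q - p) / 2 := by linarith [hx.1]
          calc (g x - g m) ^ 2 = (g m - g x) ^ 2 := by ring
            _ ≤ _ := h1
            _ ≤ _ := mul_le_mul h5 (by linarith) h4 (by linarith)
      _ = _ := by
          rw [intervalIntegral.integral_const, smul_eq_mul, hm]
          ring
  have right : ∫ x in m..q, (g x - g m) ^ 2 ≤
      (q - p) ^ 2 / 4 * ∫ x in m..q, g' x ^ 2 := by
    calc ∫ x in m..q, (g x - g m) ^ 2
        ≤ ∫ _ in m..q, (q - p) / 2 * ∫ x in m..q, g' x ^ 2 := by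
          refine intervalIntegral.integral_mono_on hmq (hci _ _) (by simp) fun x hx => ?_
          have h1 := sq_sub_le_of_hasDerivAt hg hg' hx.1
          have h2 := hadd m x q
          have h3 := hnn m x hx.1
          have h4 := hnn x q hx.2
          have h5 : x - m ≤ (q - p) / 2 := by linarith [hx.2]
          exact h1.trans (mul_le_mul h5 (by linarith) h3 (by linarith))
      _ = _ := by
          rw [intervalIntegral.integral_const, smul_eq_mul, hm]
          ring
  have key : ∫ x in p..q, (g x - g m) ^ 2 ≤ (q - p) ^ 2 / 4 * ∫ x in p..q, g' x ^ 2 := by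
    rw [← intervalIntegral.integral_add_adjacent_intervals (hci p m) (hci m q), ← hadd p m q,
      mul_add]
    exact add_le_add left right
  rw [integral_sub_const_sq hgc] at key
  set I := ∫ x in p..q, g x
  have h0 : 0 ≤ (q - p)⁻¹ * (I - (q - p) * g m) ^ 2 := by positivity
  have e : (q - p)⁻¹ * (I - (q - p) * g m) ^ 2
      = (q - p)⁻¹ * I ^ 2 - 2 * g m * I + (q - p) * g m ^ 2 := by
    field_simp
    ring
  linarith

lemma hasDerivAt_pd1 {f : ℝ × ℝ → ℝ} (hf : ContDiff ℝ 1 f) (x y : ℝ) :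
    HasDerivAt (fun t => f (t, y)) (pd1 f (x, y)) x := by
  have hd : DifferentiableAt ℝ (fun t : ℝ => f (t, y)) x :=
    ((hf.differentiable one_ne_zero).comp (by fun_prop : Differentiable ℝ fun t : ℝ => (t, y))) x
  exact hd.hasDerivAt

lemma hasDerivAt_pd2 {f : ℝ × ℝ → ℝ} (hf : ContDiff ℝ 1 f) (x y : ℝ) :
    HasDerivAt (fun t => f (x, t)) (pd2 f (x, y)) y := by
  have hd : DifferentiableAt ℝ (fun t : ℝ => f (x, t)) y :=
    ((hf.differentiable one_ne_zero).comp (by fun_prop : Differentiable ℝ fun t : ℝ => (x, t))) y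
  exact hd.hasDerivAt

lemma continuous_pd1 {f : ℝ × ℝ → ℝ} (hf : ContDiff ℝ 1 f) : Continuous (pd1 f) := by
  have e : pd1 f = fun x => fderiv ℝ f x (1, 0) := by
    ext ⟨x, y⟩
    exact (hasDerivAt_pd1 hf x y).unique
      (((hf.differentiable one_ne_zero) (x, y)).hasFDerivAt.comp_hasDerivAt x
        ((hasDerivAt_id x).prodMk (hasDerivAt_const x y)))
  rw [e]
  exact (hf.continuous_fderiv one_ne_zero).clm_apply continuous_const

lemma continuous_pd2 {f : ℝ × ℝ → ℝ} (hf : ContDiff ℝ 1 f) : Continuous (pd2 f) := by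
  have e : pd2 f = fun x => fderiv ℝ f x (0, 1) := by
    ext ⟨x, y⟩
    exact (hasDerivAt_pd2 hf x y).unique
      (((hf.differentiable one_ne_zero) (x, y)).hasFDerivAt.comp_hasDerivAt y
        ((hasDerivAt_const y x).prodMk (hasDerivAt_id y)))
  rw [e]
  exact (hf.continuous_fderiv one_ne_zero).clm_apply continuous_const

lemma hasDerivAt_integral_pd1 {f : ℝ × ℝ → ℝ} (hf : ContDiff ℝ 1 f) (c d x : ℝ) :
    HasDerivAt (fun t => ∫ y in c..d, f (t, y)) (∫ y in c..d, pd1 f (x, y)) x := by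
  have hfc := hf.continuous
  have hc := continuous_pd1 hf
  obtain ⟨C, hC⟩ := ((isCompact_Icc (a := x - 1) (b := x + 1)).prod
    (isCompact_uIcc (a := c) (b := d))).exists_bound_of_continuousOn hc.continuousOn
  refine (intervalIntegral.hasDerivAt_integral_of_dominated_loc_of_deriv_le
    (F := fun t y => f (t, y)) (F' := fun t y => pd1 f (t, y)) (bound := fun _ => C)
    (Icc_mem_nhds (sub_one_lt x) (lt_add_one x)) (.of_forall fun t => ?_) ?_ ?_
    (.of_forall fun y hy t ht => ?_) (by simp) (.of_forall fun y _ t _ => ?_)).2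
  · exact Continuous.aestronglyMeasurable (by fun_prop)
  · exact Continuous.intervalIntegrable (by fun_prop) _ _
  · exact Continuous.aestronglyMeasurable (by fun_prop)
  · exact hC (t, y) ⟨ht, Set.uIoc_subset_uIcc hy⟩
  · exact hasDerivAt_pd1 hf t y

lemma continuous_integral_right {F : ℝ × ℝ → ℝ} (hF : Continuous F) (c d : ℝ) :
    Continuous fun x => ∫ y in c..d, F (x, y) :=
  intervalIntegral.continuous_parametric_intervalIntegral_of_continuous'
    (f := fun x y => F (x, y)) hF c d

lemma integrableOn_rectangle {F : ℝ × ℝ → ℝ} (hF : Continuous F) (p q c d : ℝ) :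
    IntegrableOn F (Set.Ico p q ×ˢ Set.Ico c d) :=
  (hF.continuousOn.integrableOn_compact (isCompact_Icc.prod isCompact_Icc)).mono_set
    (Set.prod_mono Set.Ico_subset_Icc_self Set.Ico_subset_Icc_self)

lemma setIntegral_rectangle {F : ℝ × ℝ → ℝ} (hF : Continuous F) {p q c d : ℝ} (hpq : p ≤ q)
    (hcd : c ≤ d) :
    ∫ z in Set.Ico p q ×ˢ Set.Ico c d, F z = ∫ x in p..q, ∫ y in c..d, F (x, y) := by
  rw [Measure.volume_eq_prod, setIntegral_prod F (integrableOn_rectangle hF p q c d),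
    intervalIntegral.integral_of_le hpq, integral_Ico_eq_integral_Ioc]
  simp only [intervalIntegral.integral_of_le hcd, integral_Ico_eq_integral_Ioc]

/-- A Poincaré inequality on a rectangle. -/
lemma setIntegral_sq_le_rectangle {f : ℝ × ℝ → ℝ} (hf : ContDiff ℝ 1 f) {p q c d K : ℝ}
    (hpq : p < q) (hcd : c < d) (hK1 : (q - p) ^ 2 / 4 ≤ K) (hK2 : (d - c) ^ 2 / 4 ≤ K) :
    ∫ z in Set.Ico p q ×ˢ Set.Ico c d, f z ^ 2 ≤
      ((q - p) * (d - c))⁻¹ * (∫ z in Set.Ico p q ×ˢ Set.Ico c d, |f z|) ^ 2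
        + K * ∫ z in Set.Ico p q ×ˢ Set.Ico c d, (pd1 f z ^ 2 + pd2 f z ^ 2) := by
  have hfc := hf.continuous
  have h1c := continuous_pd1 hf
  have h2c := continuous_pd2 hf
  have ha : 0 < q - p := sub_pos.2 hpq
  have hb : 0 < d - c := sub_pos.2 hcd
  set G : ℝ → ℝ := fun x => ∫ y in c..d, f (x, y) with hG
  have hGc : Continuous G := continuous_integral_right hfc c d
  have hG'c : Continuous fun x => ∫ y in c..d, pd1 f (x, y) := continuous_integral_right h1c c d
  have h1s : Continuous fun x => ∫ y in c..d, pd1 f (x, y) ^ 2 :=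
    continuous_integral_right (h1c.pow 2) c d
  have h2s : Continuous fun x => ∫ y in c..d, pd2 f (x, y) ^ 2 :=
    continuous_integral_right (h2c.pow 2) c d
  have hfs : Continuous fun x => ∫ y in c..d, f (x, y) ^ 2 :=
    continuous_integral_right (hfc.pow 2) c d
  have vertical : ∫ x in p..q, ∫ y in c..d, f (x, y) ^ 2 ≤
      (d - c)⁻¹ * (∫ x in p..q, G x ^ 2)
        + (d - c) ^ 2 / 4 * ∫ x in p..q, ∫ y in c..d, pd2 f (x, y) ^ 2 := by
    rw [← intervalIntegral.integral_const_mul, ← intervalIntegral.integral_const_mul,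
      ← intervalIntegral.integral_add (Continuous.intervalIntegrable (by fun_prop) _ _)
        (Continuous.intervalIntegrable (by fun_prop) _ _)]
    refine intervalIntegral.integral_mono_on hpq.le (hfs.intervalIntegrable _ _)
      (Continuous.intervalIntegrable (by fun_prop) _ _) fun x _ => ?_
    exact integral_sq_le_of_hasDerivAt (g := fun y => f (x, y)) (g' := fun y => pd2 f (x, y))
      (fun y => hasDerivAt_pd2 hf x y) (by fun_prop) hcd
  have horizontal := integral_sq_le_of_hasDerivAt (g := G)
    (fun x => hasDerivAt_integral_pd1 hf c d x) hG'c hpq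
  have slope : ∫ x in p..q, (∫ y in c..d, pd1 f (x, y)) ^ 2 ≤
      (d - c) * ∫ x in p..q, ∫ y in c..d, pd1 f (x, y) ^ 2 := by
    rw [← intervalIntegral.integral_const_mul]
    refine intervalIntegral.integral_mono_on hpq.le ((hG'c.pow 2).intervalIntegrable _ _)
      (Continuous.intervalIntegrable (by fun_prop) _ _) fun x _ => ?_
    exact sq_integral_le (h := fun y => pd1 f (x, y)) (by fun_prop) hcd.le
  have mean : (∫ x in p..q, G x) ^ 2 ≤ (∫ z in Set.Ico p q ×ˢ Set.Ico c d, |f z|) ^ 2 := by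
    rw [hG, ← setIntegral_rectangle hfc hpq.le hcd.le]
    exact sq_le_sq.2 ((abs_integral_le_integral_abs).trans (le_abs_self _))
  rw [integral_add (integrableOn_rectangle (F := fun z => pd1 f z ^ 2) (h1c.pow 2) p q c d)
      (integrableOn_rectangle (F := fun z => pd2 f z ^ 2) (h2c.pow 2) p q c d),
    setIntegral_rectangle (F := fun z => f z ^ 2) (hfc.pow 2) hpq.le hcd.le,
    setIntegral_rectangle (F := fun z => pd1 f z ^ 2) (h1c.pow 2) hpq.le hcd.le,
    setIntegral_rectangle (F := fun z => pd2 f z ^ 2) (h2c.pow 2) hpq.le hcd.le]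
  have hD1 : 0 ≤ ∫ x in p..q, ∫ y in c..d, pd1 f (x, y) ^ 2 :=
    intervalIntegral.integral_nonneg hpq.le fun _ _ =>
      intervalIntegral.integral_nonneg hcd.le fun _ _ => sq_nonneg _
  have hD2 : 0 ≤ ∫ x in p..q, ∫ y in c..d, pd2 f (x, y) ^ 2 :=
    intervalIntegral.integral_nonneg hpq.le fun _ _ =>
      intervalIntegral.integral_nonneg hcd.le fun _ _ => sq_nonneg _
  set D1 := ∫ x in p..q, ∫ y in c..d, pd1 f (x, y) ^ 2
  set D2 := ∫ x in p..q, ∫ y in c..d, pd2 f (x, y) ^ 2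
  set A := ∫ z in Set.Ico p q ×ˢ Set.Ico c d, |f z|
  have hG2 : ∫ x in p..q, G x ^ 2 ≤ (q - p)⁻¹ * A ^ 2 + (q - p) ^ 2 / 4 * ((d - c) * D1) := by
    refine horizontal.trans ?_
    gcongr
  calc ∫ x in p..q, ∫ y in c..d, f (x, y) ^ 2
      ≤ (d - c)⁻¹ * ((q - p)⁻¹ * A ^ 2 + (q - p) ^ 2 / 4 * ((d - c) * D1))
          + (d - c) ^ 2 / 4 * D2 := by
        refine vertical.trans ?_
        gcongr
    _ = ((q - p) * (d - c))⁻¹ * A ^ 2 + ((q - p) ^ 2 / 4 * D1 + (d - c) ^ 2 / 4 * D2) := by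
        field_simp
        ring
    _ ≤ ((q - p) * (d - c))⁻¹ * A ^ 2 + K * (D1 + D2) := by
        rw [mul_add]
        gcongr

/-- The cell with index `(k, j)` of the tiling by rectangles of size `1 / R` by `1 / n`. -/
def cell (R : ℝ) (n : ℕ) (i : ℤ × Fin n) : Set (ℝ × ℝ) :=
  Set.Ico (i.1 / R) ((i.1 + 1) / R) ×ˢ Set.Ico ((i.2 : ℕ) / (n : ℝ)) (((i.2 : ℕ) + 1) / (n : ℝ))

lemma mem_cell {R : ℝ} (hR : 0 < R) {n : ℕ} (hn : 0 < n) (i : ℤ × Fin n) (x : ℝ × ℝ) :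
    x ∈ cell R n i ↔ ⌊x.1 * R⌋ = i.1 ∧ ⌊x.2 * n⌋ = ((i.2 : ℕ) : ℤ) := by
  have hn' : (0 : ℝ) < n := by exact_mod_cast hn
  simp only [cell, Set.mem_prod, Set.mem_Ico, Int.floor_eq_iff, div_le_iff₀ hR, lt_div_iff₀ hR,
    div_le_iff₀ hn', lt_div_iff₀ hn', Int.cast_natCast]

lemma pairwise_disjoint_cell {R : ℝ} (hR : 0 < R) {n : ℕ} (hn : 0 < n) :
    Pairwise (Function.onFun Disjoint (cell R n)) := by
  intro i i' hne
  refine Set.disjoint_left.2 fun x hx hx' => hne ?_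
  rw [mem_cell hR hn] at hx hx'
  refine Prod.ext (hx.1.symm.trans hx'.1) (Fin.ext ?_)
  exact_mod_cast hx.2.symm.trans hx'.2

lemma iUnion_cell {R : ℝ} (hR : 0 < R) {n : ℕ} (hn : 0 < n) :
    ⋃ i, cell R n i = Set.univ ×ˢ Set.Ico (0 : ℝ) 1 := by
  have hn' : (0 : ℝ) < n := by exact_mod_cast hn
  ext x
  simp only [Set.mem_iUnion, mem_cell hR hn, Set.mem_prod, Set.mem_univ, true_and, Set.mem_Ico]
  constructor
  · rintro ⟨⟨k, j⟩, -, hj⟩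
    obtain ⟨h1, h2⟩ := Int.floor_eq_iff.1 hj
    have hj' : ((j : ℕ) : ℝ) + 1 ≤ n := by exact_mod_cast j.2
    simp only [Int.cast_natCast] at h1 h2
    constructor
    · exact nonneg_of_mul_nonneg_left ((Nat.cast_nonneg _).trans h1) hn'
    · exact lt_of_mul_lt_mul_right (by linarith) hn'.le
  · rintro ⟨h0, h1⟩
    have hfl : 0 ≤ x.2 * n := by positivity
    refine ⟨(⌊x.1 * R⌋, ⟨⌊x.2 * n⌋₊, (Nat.floor_lt hfl).2 ?_⟩), rfl, ?_⟩
    · nlinarith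
    · exact (Int.natCast_floor_eq_floor hfl).symm

lemma hasSum_setIntegral_cell {R : ℝ} (hR : 0 < R) {n : ℕ} (hn : 0 < n) {F : ℝ × ℝ → ℝ}
    (hF : Integrable F μΩ) :
    HasSum (fun i => ∫ x in cell R n i, F x) (∫ x, F x ∂μΩ) := by
  unfold μΩ at hF ⊢
  rw [← iUnion_cell hR hn] at hF ⊢
  exact hasSum_integral_iUnion (fun _ => measurableSet_Ico.prod measurableSet_Ico)
    (pairwise_disjoint_cell hR hn) hF

/-- For every continuously differentiable `f : Ω → ℝ` with `f ∈ L¹(Ω) ∩ L²(Ω)` and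
`∇f ∈ L²(Ω)`, and every `R > 0`, one has
`‖f‖²_{L²} ≤ ‖f‖²_{L¹} * max (R, R²) + R⁻² ‖∇f‖²_{L²}`. -/
theorem fourier_cutoff_bound (f : ℝ × ℝ → ℝ) (hf : ContDiff ℝ 1 f) (hper : Periodic2 f)
    (hf1 : Integrable f μΩ) (hf2 : Integrable (fun x => f x ^ 2) μΩ)
    (hg2 : Integrable (fun x => pd1 f x ^ 2 + pd2 f x ^ 2) μΩ)
    (R : ℝ) (hR : 0 < R) :
    (∫ x, f x ^ 2 ∂μΩ) ≤ (∫ x, |f x| ∂μΩ) ^ 2 * max R (R ^ 2)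
      + (R ^ 2)⁻¹ * ∫ x, (pd1 f x ^ 2 + pd2 f x ^ 2) ∂μΩ := by
  obtain ⟨n, hn, hRn, hnR⟩ : ∃ n : ℕ, 0 < n ∧ R ≤ 2 * n ∧ R * n ≤ max R (R ^ 2) := by
    rcases le_total R 1 with h | h
    · exact ⟨1, one_pos, by norm_num; linarith, by simp⟩
    · have h1 : 1 ≤ ⌊R⌋₊ := (Nat.one_le_floor_iff R).2 h
      have h2 : (1 : ℝ) ≤ ⌊R⌋₊ := by exact_mod_cast h1
      have h3 := Nat.lt_floor_add_one R
      have h4 := Nat.floor_le hR.le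
      exact ⟨⌊R⌋₊, h1, by linarith, le_max_of_le_right (by nlinarith)⟩
  have hn' : (0 : ℝ) < n := by exact_mod_cast hn
  have s1 := hasSum_setIntegral_cell hR hn hf1.abs
  have s2 := hasSum_setIntegral_cell hR hn hf2
  have s3 := hasSum_setIntegral_cell hR hn hg2
  set S := ∫ x, |f x| ∂μΩ
  have hS : 0 ≤ S := integral_nonneg fun _ => abs_nonneg _
  have e : S ^ 2 * max R (R ^ 2) = S * max R (R ^ 2) * S := by ring
  rw [e]
  refine hasSum_le (fun i => ?_) s2
    ((s1.mul_left (S * max R (R ^ 2))).add (s3.mul_left (R ^ 2)⁻¹))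
  have ew : ((i.1 : ℝ) + 1) / R - i.1 / R = R⁻¹ := by field_simp; ring
  have eh : (((i.2 : ℕ) : ℝ) + 1) / n - (i.2 : ℕ) / n = (n : ℝ)⁻¹ := by field_simp; ring
  have hA : 0 ≤ ∫ x in cell R n i, |f x| := integral_nonneg fun _ => abs_nonneg _
  have hAS : ∫ x in cell R n i, |f x| ≤ S :=
    le_hasSum s1 i fun _ _ => integral_nonneg fun _ => abs_nonneg _
  refine (setIntegral_sq_le_rectangle hf (K := (R ^ 2)⁻¹)
    (sub_pos.1 (ew ▸ inv_pos.2 hR)) (sub_pos.1 (eh ▸ inv_pos.2 hn')) ?_ ?_).trans ?_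
  · rw [ew, inv_pow]
    have : 0 < (R ^ 2)⁻¹ := by positivity
    linarith
  · have h1 : R ^ 2 ≤ n ^ 2 * 4 := by nlinarith
    rw [eh, inv_pow, inv_eq_one_div, div_div, ← one_div]
    gcongr
  · rw [ew, eh, mul_inv, inv_inv, inv_inv]
    refine add_le_add_left ?_ _
    change R * n * (∫ x in cell R n i, |f x|) ^ 2 ≤ _
    set A := ∫ x in cell R n i, |f x|
    calc R * n * A ^ 2 ≤ max R (R ^ 2) * (S * A) := by
          rw [sq A]
          gcongr
      _ = _ := by ring

end NS
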